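/- Assume F is L-Lipschitz on the support of μ, μ(e^{-F}) = 1, C_{LS}(μ) < ∞, and sup_{x ∈ supp(μ)} F(x) = M < ∞. Then for every θ > 0, C_{LS}(μ_F) ≤ (1 + θ⁻¹) C_{LS}(μ) + C_P(μ_F) · ( ((1+θ)/4) L² C_{LS}(μ) + M + 2 ). -/

import Mathlib

open MeasureTheory Real Set
open scoped ENNReal RealInnerProductSpace Pointwise Matrix

noncomputable section

/-- Euclidean space ℝ^n. -/
abbrev En (n : ℕ) := EuclideanSpace ℝ (Fin n)

/-- Test functions: smooth, bounded and Lipschitz. -/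
def IsTestFun {n : ℕ} (f : En n → ℝ) : Prop :=
  ContDiff ℝ (⊤ : ℕ∞) f ∧ (∃ M, ∀ x, |f x| ≤ M) ∧ ∃ L, LipschitzWith L f

/-- `μ` satisfies a Poincaré inequality with constant `C`. -/
def PoincareLE {n : ℕ} (μ : Measure (En n)) (C : ℝ) : Prop :=
  ∀ f : En n → ℝ, IsTestFun f →
    (∫ x, (f x) ^ 2 ∂μ) - (∫ x, f x ∂μ) ^ 2 ≤ C * ∫ x, ‖gradient f x‖ ^ 2 ∂μ

/-- `μ` satisfies a logarithmic Sobolev inequality with constant `C`. -/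
def LogSobolevLE {n : ℕ} (μ : Measure (En n)) (C : ℝ) : Prop :=
  ∀ f : En n → ℝ, IsTestFun f →
    (∫ x, (f x) ^ 2 * Real.log ((f x) ^ 2) ∂μ)
        - (∫ x, (f x) ^ 2 ∂μ) * Real.log (∫ x, (f x) ^ 2 ∂μ)
      ≤ C * ∫ x, ‖gradient f x‖ ^ 2 ∂μ

/-- `μ` satisfies an L¹-Poincaré inequality (around the mean) with constant `C`. -/
def CheegerMeanLE {n : ℕ} (μ : Measure (En n)) (C : ℝ) : Prop :=
  ∀ f : En n → ℝ, IsTestFun f →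
    ∫ x, |f x - ∫ y, f y ∂μ| ∂μ ≤ C * ∫ x, ‖gradient f x‖ ∂μ

/-- `m` is a median of `f` under `μ`. -/
def IsMedian {n : ℕ} (μ : Measure (En n)) (f : En n → ℝ) (m : ℝ) : Prop :=
  ENNReal.ofReal (1 / 2) ≤ μ {x | f x ≤ m} ∧ ENNReal.ofReal (1 / 2) ≤ μ {x | m ≤ f x}

/-- `μ` satisfies a Cheeger inequality (around medians) with constant `C`. -/
def CheegerMedianLE {n : ℕ} (μ : Measure (En n)) (C : ℝ) : Prop :=
  ∀ f : En n → ℝ, IsTestFun f → ∀ m : ℝ, IsMedian μ f m →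
    ∫ x, |f x - m| ∂μ ≤ C * ∫ x, ‖gradient f x‖ ∂μ

/-- The perturbed (normalized) measure `μ_F = Z_F⁻¹ e^{-F} μ`. -/
def perturb {n : ℕ} (μ : Measure (En n)) (F : En n → ℝ) : Measure (En n) :=
  (ENNReal.ofReal (∫ x, Real.exp (-F x) ∂μ))⁻¹ •
    μ.withDensity fun x => ENNReal.ofReal (Real.exp (-F x))

/-- Topological support of a measure. -/
def measSupport {n : ℕ} (μ : Measure (En n)) : Set (En n) :=
  {x | ∀ U ∈ nhds x, 0 < μ U}

/-- `μ` is log-concave: it has density `e^{-W}` on a convex set, with `W` convex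
(equivalently, density `e^{-W}` with `W : ℝⁿ → ℝ ∪ {+∞}` convex). -/
def IsLogConcave {n : ℕ} (μ : Measure (En n)) : Prop :=
  ∃ (s : Set (En n)) (W : En n → ℝ), Convex ℝ s ∧ ConvexOn ℝ s W ∧
    μ = volume.withDensity (s.indicator fun x => ENNReal.ofReal (Real.exp (-W x)))

/-- The Laplacian of `F`. -/
def laplacian {n : ℕ} (F : En n → ℝ) (x : En n) : ℝ :=
  ∑ i : Fin n,
    fderiv ℝ (fun y => fderiv ℝ F y (EuclideanSpace.single i (1 : ℝ))) x
      (EuclideanSpace.single i (1 : ℝ))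

/-- The generator `A F = ΔF - ∇V·∇F` associated with `μ = e^{-V} dx`. -/
def genA {n : ℕ} (V F : En n → ℝ) (x : En n) : ℝ :=
  laplacian F x - ⟪gradient V x, gradient F x⟫

/-- The centered Gaussian measure on ℝ^n with covariance matrix `σ² Id`. -/
def gaussMeasure (n : ℕ) (σ : ℝ) : Measure (En n) :=
  volume.withDensity fun x =>
    ENNReal.ofReal ((2 * π * σ ^ 2) ^ (-(n : ℝ) / 2) * Real.exp (-‖x‖ ^ 2 / (2 * σ ^ 2)))

/-- Convolution of two measures. -/
def mconv {n : ℕ} (μ ν : Measure (En n)) : Measure (En n) :=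
  (μ.prod ν).map fun p => p.1 + p.2

/-- Concentration profile of `μ`. -/
def concProfile {n : ℕ} (μ : Measure (En n)) (r : ℝ) : ℝ :=
  sSup {t | ∃ A : Set (En n), MeasurableSet A ∧ (1 : ℝ) / 2 ≤ (μ A).toReal ∧
    t = 1 - (μ (A + Metric.ball (0 : En n) r)).toReal}

/-- Generalized inverse of the concentration profile. -/
def concInv {n : ℕ} (μ : Measure (En n)) (s : ℝ) : ℝ :=
  sInf {r | 0 < r ∧ concProfile μ r ≤ s}

/-- The Hessian matrix of `V` at `x`. -/
def hessMat {n : ℕ} (V : En n → ℝ) (x : En n) : Matrix (Fin n) (Fin n) ℝ :=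
  fun i j =>
    fderiv ℝ (fun y => fderiv ℝ V y (EuclideanSpace.single j (1 : ℝ))) x
      (EuclideanSpace.single i (1 : ℝ))

end



lemma le_of_hasDerivAt_nonneg_off_point {f f' : ℝ → ℝ} (hf : Continuous f) (c : ℝ)
    (hd : ∀ x, 0 < x → x ≠ c → HasDerivAt f (f' x) x ∧ 0 ≤ f' x) {t : ℝ} (ht : 0 ≤ t) :
    f 0 ≤ f t := by
  have key : ∀ a b : ℝ, 0 ≤ a → a ≤ b → c ∉ Ioo a b → f a ≤ f b := fun a b ha hab hc ↦ by
    have hd' : ∀ x ∈ interior (Icc a b), HasDerivAt f (f' x) x ∧ 0 ≤ f' x := fun x hx ↦ by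
      rw [interior_Icc] at hx
      exact hd x (ha.trans_lt hx.1) fun h ↦ hc (h ▸ hx)
    refine monotoneOn_of_deriv_nonneg (convex_Icc a b) hf.continuousOn
      (fun x hx ↦ (hd' x hx).1.differentiableAt.differentiableWithinAt)
      (fun x hx ↦ (hd' x hx).1.deriv ▸ (hd' x hx).2)
      (left_mem_Icc.2 hab) (right_mem_Icc.2 hab) hab
  by_cases hc : c ∈ Ioo 0 t
  · exact (key 0 c le_rfl hc.1.le fun h ↦ lt_irrefl _ h.2).trans
      (key c t hc.1.le hc.2.le fun h ↦ lt_irrefl _ h.1)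
  · exact key 0 t le_rfl ht hc

lemma mul_log_le_mul_log_add_sub {x y : ℝ} (hx : 0 ≤ x) (hy : 0 < y) :
    x * log y ≤ x * log x - x + y := by
  rcases hx.eq_or_lt with rfl | hx
  · simpa using hy.le
  have h := log_le_sub_one_of_pos (div_pos hy hx)
  rw [log_div hy.ne' hx.ne'] at h
  have h2 := mul_le_mul_of_nonneg_left h hx.le
  have h3 : x * (y / x - 1) = y - x := by field_simp
  linarith [mul_sub x (log y) (log x)]

lemma continuous_sq_mul_log_sq : Continuous fun x : ℝ ↦ x ^ 2 * log (x ^ 2) :=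
  continuous_mul_log.comp (continuous_pow 2)

lemma one_add_mul_sq_mul_log_le (g : ℝ) {t : ℝ} (ht : 0 ≤ t) :
    (1 + t * g) ^ 2 * log ((1 + t * g) ^ 2) ≤
      2 * t * g + t ^ 2 * (g ^ 2 * log (g ^ 2)) + 2 * t ^ 2 * g ^ 2
        + g ^ 2 * ((t ^ 2 - 1) * log (1 + t ^ 2) - 3 * t ^ 2 + 4 * (t * arctan t))
        + 2 * (1 - g ^ 2) * (t * arctan t - log (1 + t ^ 2) / 2)
        + 2 * g * (t * log (1 + t ^ 2) - 2 * t + 2 * arctan t) + g ^ 2 * t ^ 2 := by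
  set R : ℝ → ℝ := fun t ↦ 2 * t * g + t ^ 2 * (g ^ 2 * log (g ^ 2)) + 2 * t ^ 2 * g ^ 2
        + g ^ 2 * ((t ^ 2 - 1) * log (1 + t ^ 2) - 3 * t ^ 2 + 4 * (t * arctan t))
        + 2 * (1 - g ^ 2) * (t * arctan t - log (1 + t ^ 2) / 2)
        + 2 * g * (t * log (1 + t ^ 2) - 2 * t + 2 * arctan t) + g ^ 2 * t ^ 2 with hR
  set D : ℝ → ℝ := fun t ↦ 2 * g + 2 * t * (g ^ 2 * log (g ^ 2)) + 4 * t * g ^ 2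
        + g ^ 2 * (2 * (t * log (1 + t ^ 2)) - 4 * t + 4 * arctan t)
        + 2 * (1 - g ^ 2) * arctan t + 2 * g * log (1 + t ^ 2) + 2 * g ^ 2 * t with hD
  have hpos : ∀ t : ℝ, 0 < 1 + t ^ 2 := fun t ↦ by positivity
  have hlog : ∀ t : ℝ, HasDerivAt (fun t : ℝ ↦ log (1 + t ^ 2)) (2 * t / (1 + t ^ 2)) t :=
    fun t ↦ by
      simpa using ((hasDerivAt_pow 2 t).const_add 1).log (hpos t).ne'
  have hsq : ∀ t : ℝ, HasDerivAt (fun t : ℝ ↦ t ^ 2) (2 * t) t := fun t ↦ by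
    simpa using hasDerivAt_pow 2 t
  have hid : ∀ t : ℝ, HasDerivAt (fun t : ℝ ↦ t) 1 t := hasDerivAt_id'
  have hRD : ∀ t, HasDerivAt R (D t) t := fun t ↦ by
    have hta := (hid t).mul (hasDerivAt_arctan t)
    have h := (((((((hid t).const_mul 2).mul_const g).add
      ((hsq t).mul_const (g ^ 2 * log (g ^ 2)))).add (((hsq t).const_mul 2).mul_const (g ^ 2))).add
      ((((((hsq t).sub_const 1).mul (hlog t)).sub ((hsq t).const_mul 3)).add
        (hta.const_mul 4)).const_mul (g ^ 2))).add
      ((hta.sub ((hlog t).div_const 2)).const_mul (2 * (1 - g ^ 2)))).add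
      (((((hid t).mul (hlog t)).sub ((hid t).const_mul 2)).add
        ((hasDerivAt_arctan t).const_mul 2)).const_mul (2 * g)) |>.add ((hsq t).const_mul (g ^ 2))
    refine h.congr_deriv ?_
    have := (hpos t).ne'
    simp only [hD]
    field_simp
    ring
  have hDD : ∀ t, HasDerivAt D (2 * (g ^ 2 * log (g ^ 2)) + 6 * g ^ 2 + 2 * g ^ 2 * log (1 + t ^ 2)
      + 2 * ((1 + t * g) ^ 2 / (1 + t ^ 2) - g ^ 2)) t := fun t ↦ by
    have h := (((((((hid t).const_mul 2).mul_const (g ^ 2 * log (g ^ 2))).const_add (2 * g)).add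
      (((hid t).const_mul 4).mul_const (g ^ 2))).add
      ((((((hid t).mul (hlog t)).const_mul 2).sub ((hid t).const_mul 4)).add
        ((hasDerivAt_arctan t).const_mul 4)).const_mul (g ^ 2))).add
      ((hasDerivAt_arctan t).const_mul (2 * (1 - g ^ 2)))).add
      ((hlog t).const_mul (2 * g)) |>.add ((hid t).const_mul (2 * g ^ 2))
    refine h.congr_deriv ?_
    have := (hpos t).ne'
    field_simp
    ring
  have hu : ∀ t : ℝ, HasDerivAt (fun t : ℝ ↦ 1 + t * g) g t := fun t ↦ by
    simpa using ((hid t).mul_const g).const_add 1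
  have hlu : ∀ t : ℝ, 1 + t * g ≠ 0 → HasDerivAt (fun t : ℝ ↦ log ((1 + t * g) ^ 2))
      (2 * (1 + t * g) * g / (1 + t * g) ^ 2) t := fun t h0 ↦ by
    simpa using ((hu t).pow 2).log (pow_ne_zero 2 h0)
  have hne : ∀ x, x ≠ -1 / g → 1 + x * g ≠ 0 := fun x hx h0 ↦ by
    rcases eq_or_ne g 0 with rfl | hg
    · simp at h0
    · exact hx (by rw [eq_div_iff hg]; linarith)
  have hc : Continuous fun t : ℝ ↦ (1 + t * g) * log ((1 + t * g) ^ 2) := by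
    have : Continuous fun x : ℝ ↦ x * log (x ^ 2) := by
      convert continuous_mul_log.const_mul 2 using 2 with x
      rw [log_pow]; push_cast; ring
    exact this.comp (by fun_prop : Continuous fun t : ℝ ↦ 1 + t * g)
  have hDnn : ∀ t, 0 ≤ t →
      2 * g * ((1 + t * g) * log ((1 + t * g) ^ 2)) + 2 * g * (1 + t * g) ≤ D t := fun t ht ↦ by
    have := le_of_hasDerivAt_nonneg_off_point
      (f := fun t ↦ D t - (2 * g * ((1 + t * g) * log ((1 + t * g) ^ 2)) + 2 * g * (1 + t * g)))
      (((continuous_iff_continuousAt.2 fun t ↦ (hDD t).continuousAt)).sub (by fun_prop)) (-1 / g)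
      (fun x hx0 hx ↦ ⟨(hDD x).sub (((((hu x).mul (hlu x (hne x hx))).const_mul (2 * g)).add
        ((hu x).const_mul (2 * g)))), ?_⟩) ht
    · simp [hD, -log_pow] at this
      linarith
    · have hux := hne x hx
      have h1 := mul_log_le_mul_log_add_sub (sq_nonneg g)
        (div_pos (pow_pos (abs_pos.2 hux) 2) (hpos x))
      rw [sq_abs, log_div (pow_ne_zero 2 hux) (hpos x).ne'] at h1
      have h2 : (1 + x * g) * (2 * (1 + x * g) * g / (1 + x * g) ^ 2) = 2 * g := by
        field_simp
      rw [h2]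
      linarith
  have := le_of_hasDerivAt_nonneg_off_point
      (f := fun t ↦ R t - (1 + t * g) ^ 2 * log ((1 + t * g) ^ 2))
      (f' := fun t ↦ D t - (2 * g * ((1 + t * g) * log ((1 + t * g) ^ 2)) + 2 * g * (1 + t * g)))
      (((continuous_iff_continuousAt.2 fun t ↦ (hRD t).continuousAt)).sub
        (continuous_sq_mul_log_sq.comp (by fun_prop : Continuous fun t : ℝ ↦ 1 + t * g))) (-1 / g)
      (fun x hx0 hx ↦ ⟨?_, sub_nonneg.2 (hDnn x hx0.le)⟩) ht
  · simp [hR, -log_pow] at this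
    linarith
  · refine ((hRD x).sub (((hu x).pow 2).mul (hlu x (hne x hx)))).congr_deriv ?_
    have hux := hne x hx
    simp only [Nat.cast_ofNat, Nat.add_one_sub_one, pow_one, Pi.pow_apply]
    field_simp

lemma arctan_le_self {t : ℝ} (ht : 0 ≤ t) : arctan t ≤ t := by
  have := le_of_hasDerivAt_nonneg_off_point (f := fun t ↦ t - arctan t)
    (continuous_id.sub continuous_arctan) 0
    (fun x _ _ ↦ ⟨(hasDerivAt_id' x).sub (hasDerivAt_arctan x), sub_nonneg.2 <|
      div_le_one_of_le₀ (by nlinarith) (by positivity)⟩) ht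
  simpa using this

lemma two_mul_mul_arctan_le {t : ℝ} (ht : 0 ≤ t) :
    2 * (t * arctan t) ≤ log (1 + t ^ 2) + t ^ 2 := by
  have hpos : ∀ t : ℝ, 0 < 1 + t ^ 2 := fun t ↦ by positivity
  have hd : ∀ x : ℝ, HasDerivAt (fun t ↦ log (1 + t ^ 2) + t ^ 2 - 2 * (t * arctan t))
      (2 * (x - arctan x)) x := fun x ↦ by
    have hsq : HasDerivAt (fun t : ℝ ↦ t ^ 2) (2 * x) x := by simpa using hasDerivAt_pow 2 x
    refine ((((hsq.const_add 1).log (hpos x).ne').add hsq).sub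
      (((hasDerivAt_id' x).mul (hasDerivAt_arctan x)).const_mul 2)).congr_deriv ?_
    have := (hpos x).ne'
    field_simp
    ring
  have := le_of_hasDerivAt_nonneg_off_point
    (continuous_iff_continuousAt.2 fun x ↦ (hd x).continuousAt) 0
    (fun x hx _ ↦ ⟨hd x, mul_nonneg two_pos.le (sub_nonneg.2 (arctan_le_self hx.le))⟩) ht
  simp at this
  linarith

section Rothaus

variable {Ω : Type*} [MeasurableSpace Ω] {ν : Measure Ω} [IsProbabilityMeasure ν]

lemma integrable_comp_of_continuous_of_bound {g : Ω → ℝ} (hg : Measurable g) {K : ℝ}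
    (hK : ∀ x, |g x| ≤ K) {φ : ℝ → ℝ} (hφ : Continuous φ) : Integrable (fun x ↦ φ (g x)) ν := by
  obtain ⟨B, hB⟩ := (isCompact_Icc (a := -K) (b := K)).exists_bound_of_continuousOn hφ.continuousOn
  exact Integrable.of_bound (hφ.measurable.comp hg).aestronglyMeasurable B
    (ae_of_all _ fun x ↦ hB _ (abs_le.1 (hK x)))

lemma entropy_one_add_mul_le {g : Ω → ℝ} (hg : Measurable g) {K : ℝ} (hK : ∀ x, |g x| ≤ K)
    (h0 : ∫ x, g x ∂ν = 0) (h1 : ∫ x, g x ^ 2 ∂ν = 1) {t : ℝ} (ht : 0 ≤ t) :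
    ∫ x, (1 + t * g x) ^ 2 * log ((1 + t * g x) ^ 2) ∂ν ≤
      (1 + t ^ 2) * log (1 + t ^ 2) + t ^ 2 * (∫ x, g x ^ 2 * log (g x ^ 2) ∂ν + 2) := by
  have i1 : Integrable g ν := integrable_comp_of_continuous_of_bound hg hK continuous_id
  have i2 : Integrable (fun x ↦ g x ^ 2) ν :=
    integrable_comp_of_continuous_of_bound hg hK (continuous_pow 2)
  have i3 : Integrable (fun x ↦ g x ^ 2 * log (g x ^ 2)) ν :=
    integrable_comp_of_continuous_of_bound hg hK continuous_sq_mul_log_sq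
  have i4 : Integrable (fun x ↦ (1 + t * g x) ^ 2 * log ((1 + t * g x) ^ 2)) ν :=
    integrable_comp_of_continuous_of_bound hg hK
      (φ := fun y ↦ (1 + t * y) ^ 2 * log ((1 + t * y) ^ 2))
      (continuous_sq_mul_log_sq.comp (by fun_prop : Continuous fun y : ℝ ↦ 1 + t * y))
  set a := 2 * t + 2 * (t * log (1 + t ^ 2) - 2 * t + 2 * arctan t)
  set b := 3 * t ^ 2 + ((t ^ 2 - 1) * log (1 + t ^ 2) - 3 * t ^ 2 + 4 * (t * arctan t))
    - 2 * (t * arctan t - log (1 + t ^ 2) / 2)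
  set c := 2 * (t * arctan t - log (1 + t ^ 2) / 2)
  have key : ∀ x, (1 + t * g x) ^ 2 * log ((1 + t * g x) ^ 2) ≤
      a * g x + t ^ 2 * (g x ^ 2 * log (g x ^ 2)) + b * g x ^ 2 + c := fun x ↦ by
    refine (one_add_mul_sq_mul_log_le (g x) ht).trans_eq ?_
    simp only [a, b, c]
    ring
  have hle := integral_mono i4 ((((i1.const_mul a).add (i3.const_mul (t ^ 2))).add
    (i2.const_mul b)).add (integrable_const c)) key
  refine hle.trans ?_
  simp only [Pi.add_apply]
  rw [integral_add (by fun_prop) (by fun_prop), integral_add (by fun_prop) (by fun_prop),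
    integral_add (by fun_prop) (by fun_prop), integral_const_mul, integral_const_mul,
    integral_const_mul, h0, h1]
  simp only [integral_const, probReal_univ, smul_eq_mul, a, b, c]
  have := two_mul_mul_arctan_le ht
  linarith

lemma entropy_add_const_le_of_pos {g : Ω → ℝ} (hg : Measurable g) {K : ℝ}
    (hK : ∀ x, |g x| ≤ K) (h0 : ∫ x, g x ∂ν = 0) {c : ℝ} (hc : 0 < c) :
    ∫ x, (g x + c) ^ 2 * log ((g x + c) ^ 2) ∂ν
        - (∫ x, (g x + c) ^ 2 ∂ν) * log (∫ x, (g x + c) ^ 2 ∂ν) ≤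
      ∫ x, g x ^ 2 * log (g x ^ 2) ∂ν - (∫ x, g x ^ 2 ∂ν) * log (∫ x, g x ^ 2 ∂ν)
        + 2 * ∫ x, g x ^ 2 ∂ν := by
  have i1 : Integrable g ν := integrable_comp_of_continuous_of_bound hg hK continuous_id
  have i2 : Integrable (fun x ↦ g x ^ 2) ν :=
    integrable_comp_of_continuous_of_bound hg hK (continuous_pow 2)
  have i3 : Integrable (fun x ↦ g x ^ 2 * log (g x ^ 2)) ν :=
    integrable_comp_of_continuous_of_bound hg hK continuous_sq_mul_log_sq
  have hsq : ∫ x, (g x + c) ^ 2 ∂ν = ∫ x, g x ^ 2 ∂ν + c ^ 2 := by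
    have : ∀ x, (g x + c) ^ 2 = g x ^ 2 + 2 * c * g x + c ^ 2 := fun x ↦ by ring
    simp_rw [this]
    rw [integral_add (by fun_prop) (by fun_prop), integral_add (by fun_prop) (by fun_prop),
      integral_const_mul, h0]
    simp
  have hnn : 0 ≤ ∫ x, g x ^ 2 ∂ν := integral_nonneg fun x ↦ sq_nonneg _
  rcases hnn.eq_or_lt with hz | hpos
  · have hz' := (integral_eq_zero_iff_of_nonneg (fun x ↦ sq_nonneg (g x)) i2).1 hz.symm
    have h3 : ∫ x, (g x + c) ^ 2 * log ((g x + c) ^ 2) ∂ν = c ^ 2 * log (c ^ 2) := by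
      rw [integral_congr_ae (g := fun _ ↦ c ^ 2 * log (c ^ 2))]
      · simp
      · filter_upwards [hz'] with x hx
        have : g x = 0 := by simpa using hx
        simp [this]
    have h4 : ∫ x, g x ^ 2 * log (g x ^ 2) ∂ν = 0 := by
      rw [integral_congr_ae (g := fun _ ↦ (0 : ℝ))]
      · simp
      · filter_upwards [hz'] with x hx
        have : g x = 0 := by simpa using hx
        simp [this]
    rw [hsq, ← hz, h3, h4]
    simp
  set v := ∫ x, g x ^ 2 ∂ν with hv
  set σ := √v
  have hσ : 0 < σ := sqrt_pos.2 hpos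
  have hσ2 : σ ^ 2 = v := sq_sqrt hpos.le
  set t := σ / c
  have ht : 0 < t := div_pos hσ hc
  have hE := entropy_one_add_mul_le (ν := ν) (g := fun x ↦ g x / σ) (hg.div_const σ) (K := K / σ)
    (fun x ↦ by rw [abs_div, abs_of_pos hσ]; gcongr; exact hK x)
    (by rw [integral_div, h0, zero_div])
    (by simp_rw [div_pow]; rw [integral_div, ← hv, hσ2, div_self hpos.ne']) ht.le
  have e1 : ∀ x, (1 + t * (g x / σ)) ^ 2 * log ((1 + t * (g x / σ)) ^ 2) =
      ((g x + c) ^ 2 * log ((g x + c) ^ 2) - log (c ^ 2) * (g x + c) ^ 2) / c ^ 2 := fun x ↦ by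
    have : 1 + t * (g x / σ) = (g x + c) / c := by simp only [t]; field_simp; ring
    rw [this, div_pow]
    by_cases h : g x + c = 0
    · simp [h]
    · rw [log_div (by positivity) (by positivity)]; ring
  have e2 : ∀ x, (g x / σ) ^ 2 * log ((g x / σ) ^ 2) =
      (g x ^ 2 * log (g x ^ 2) - log v * g x ^ 2) / v := fun x ↦ by
    rw [div_pow, hσ2]
    by_cases h : g x = 0
    · simp [h]
    · rw [log_div (by positivity) (by positivity)]; ring
  have i4 : Integrable (fun x ↦ (g x + c) ^ 2 * log ((g x + c) ^ 2)) ν :=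
    integrable_comp_of_continuous_of_bound hg hK
      (φ := fun y ↦ (y + c) ^ 2 * log ((y + c) ^ 2))
      (continuous_sq_mul_log_sq.comp (by fun_prop : Continuous fun y : ℝ ↦ y + c))
  have i5 : Integrable (fun x ↦ (g x + c) ^ 2) ν :=
    integrable_comp_of_continuous_of_bound hg hK (φ := fun y ↦ (y + c) ^ 2) (by fun_prop)
  simp_rw [e1, e2] at hE
  rw [integral_div, integral_div, integral_sub i4 (i5.const_mul _),
    integral_sub i3 (i2.const_mul _), integral_const_mul, integral_const_mul, hsq, ← hv] at hE
  have ht2 : t ^ 2 = v / c ^ 2 := by rw [div_pow, hσ2]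
  have hlog : log (1 + t ^ 2) = log (v + c ^ 2) - log (c ^ 2) := by
    rw [← log_div (by positivity) (by positivity), ht2]
    congr 1
    field_simp
    ring
  rw [hlog, ht2, div_le_iff₀ (by positivity)] at hE
  rw [hsq]
  have e3 : ((1 + v / c ^ 2) * (log (v + c ^ 2) - log (c ^ 2)) + v / c ^ 2 *
      ((∫ x, g x ^ 2 * log (g x ^ 2) ∂ν - log v * v) / v + 2)) * c ^ 2 =
      (v + c ^ 2) * (log (v + c ^ 2) - log (c ^ 2)) +
        (∫ x, g x ^ 2 * log (g x ^ 2) ∂ν - log v * v) + 2 * v := by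
    field_simp
    ring
  rw [e3] at hE
  linarith

/-- Rothaus' inequality: translating a centred function by a constant increases the entropy of
its square by at most twice its variance. -/
lemma entropy_add_const_le {g : Ω → ℝ} (hg : Measurable g) {K : ℝ}
    (hK : ∀ x, |g x| ≤ K) (h0 : ∫ x, g x ∂ν = 0) (c : ℝ) :
    ∫ x, (g x + c) ^ 2 * log ((g x + c) ^ 2) ∂ν
        - (∫ x, (g x + c) ^ 2 ∂ν) * log (∫ x, (g x + c) ^ 2 ∂ν) ≤
      ∫ x, g x ^ 2 * log (g x ^ 2) ∂ν - (∫ x, g x ^ 2 ∂ν) * log (∫ x, g x ^ 2 ∂ν)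
        + 2 * ∫ x, g x ^ 2 ∂ν := by
  rcases lt_trichotomy c 0 with hc | rfl | hc
  · have := entropy_add_const_le_of_pos (ν := ν) (g := fun x ↦ -g x) hg.neg
      (fun x ↦ (abs_neg _).trans_le (hK x)) (by rw [integral_neg, h0, neg_zero]) (neg_pos.2 hc)
    have e : ∀ x, (-g x + -c) ^ 2 = (g x + c) ^ 2 := fun x ↦ by ring
    simpa only [e, neg_sq] using this
  · have : 0 ≤ ∫ x, g x ^ 2 ∂ν := integral_nonneg fun x ↦ sq_nonneg _
    simp only [add_zero]
    linarith
  · exact entropy_add_const_le_of_pos hg hK h0 hc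

end Rothaus

section Approximation

lemma LipschitzWith.exists_contDiff_dist_le {E : Type*} [NormedAddCommGroup E] [NormedSpace ℝ E]
    [FiniteDimensional ℝ E] {f : E → ℝ} {K : NNReal} (hf : LipschitzWith K f) {ε : ℝ}
    (hε : 0 < ε) :
    ∃ h : E → ℝ, ContDiff ℝ (⊤ : ℕ∞) h ∧ LipschitzWith K h ∧ ∀ x, dist (h x) (f x) ≤ ε := by
  borelize E
  set μ : Measure E := MeasureTheory.Measure.addHaar
  obtain ⟨δ, hδ, hfδ⟩ := Metric.uniformContinuous_iff.1 hf.uniformContinuous ε hε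
  let φ : ContDiffBump (0 : E) := ⟨δ / 2, δ, half_pos hδ, half_lt_self hδ⟩
  have hconv : ∀ x, Integrable (fun y ↦ φ.normed μ y • f (x - y)) μ := fun x ↦
    (φ.hasCompactSupport_normed.convolutionExists_left (ContinuousLinearMap.lsmul ℝ ℝ)
      φ.continuous_normed hf.continuous.locallyIntegrable x).integrable
  refine ⟨convolution (φ.normed μ) f (ContinuousLinearMap.lsmul ℝ ℝ) μ, ?_, ?_, ?_⟩
  · exact φ.hasCompactSupport_normed.contDiff_convolution_left _ φ.contDiff_normed
      hf.continuous.locallyIntegrable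
  · refine LipschitzWith.of_dist_le_mul fun x y ↦ ?_
    simp only [convolution_def, ContinuousLinearMap.lsmul_apply]
    rw [dist_eq_norm, ← integral_sub (hconv x) (hconv y)]
    refine (norm_integral_le_of_norm_le (φ.integrable_normed.mul_const (K * dist x y))
      (ae_of_all _ fun z ↦ ?_)).trans_eq ?_
    · rw [← smul_sub, norm_smul, Real.norm_of_nonneg (φ.nonneg_normed z)]
      refine mul_le_mul_of_nonneg_left ?_ (φ.nonneg_normed z)
      rw [← dist_eq_norm]
      simpa using hf.dist_le_mul (x - z) (y - z)
    · rw [integral_mul_const, φ.integral_normed, one_mul]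
  · exact fun x ↦ φ.dist_normed_convolution_le hf.continuous.aestronglyMeasurable
      fun y hy ↦ (hfδ hy).le

lemma norm_gradient_eq_norm_fderiv {n : ℕ} (f : En n → ℝ) (x : En n) :
    ‖gradient f x‖ = ‖fderiv ℝ f x‖ := by
  simp [gradient]

lemma IsTestFun.continuous_norm_gradient_sq {n : ℕ} {f : En n → ℝ} (hf : IsTestFun f) :
    Continuous fun x ↦ ‖gradient f x‖ ^ 2 := by
  simp_rw [norm_gradient_eq_norm_fderiv]
  exact ((hf.1.continuous_fderiv (by simp)).norm).pow 2

lemma IsTestFun.exists_norm_gradient_sq_le {n : ℕ} {f : En n → ℝ} (hf : IsTestFun f) :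
    ∃ B, ∀ x, ‖gradient f x‖ ^ 2 ≤ B := by
  obtain ⟨K, hK⟩ := hf.2.2
  refine ⟨K ^ 2, fun x ↦ ?_⟩
  rw [norm_gradient_eq_norm_fderiv]
  have := norm_fderiv_le_of_lipschitz ℝ hK (x₀ := x)
  gcongr

lemma IsTestFun.sub_const {n : ℕ} {f : En n → ℝ} (hf : IsTestFun f) (c : ℝ) :
    IsTestFun fun x ↦ f x - c := by
  obtain ⟨h1, ⟨B, hB⟩, K, hK⟩ := hf
  refine ⟨h1.sub contDiff_const, ⟨B + |c|, fun x ↦ (abs_sub _ _).trans (by gcongr; exact hB x)⟩,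
    K, LipschitzWith.of_dist_le_mul fun x y ↦ ?_⟩
  simpa using hK.dist_le_mul x y

lemma norm_add_sq_le_of_pos {E : Type*} [SeminormedAddCommGroup E] (a b : E) {θ : ℝ}
    (hθ : 0 < θ) : ‖a + b‖ ^ 2 ≤ (1 + θ⁻¹) * ‖a‖ ^ 2 + (1 + θ) * ‖b‖ ^ 2 := by
  have h1 : ‖a + b‖ ^ 2 ≤ (‖a‖ + ‖b‖) ^ 2 := by
    gcongr
    exact norm_add_le a b
  have h2 : 0 ≤ θ⁻¹ * (‖a‖ - θ * ‖b‖) ^ 2 := by positivity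
  have h3 : θ⁻¹ * (‖a‖ - θ * ‖b‖) ^ 2 = θ⁻¹ * ‖a‖ ^ 2 + θ * ‖b‖ ^ 2 - 2 * (‖a‖ * ‖b‖) := by
    field_simp
    ring
  nlinarith

variable {n : ℕ} {G g : En n → ℝ} {K : NNReal}

lemma hasFDerivAt_mul_exp_neg_half (hG : ContDiff ℝ (⊤ : ℕ∞) G) (hg : IsTestFun g) (x : En n) :
    HasFDerivAt (fun x ↦ g x * exp (-G x / 2))
      (exp (-G x / 2) • (fderiv ℝ g x + (-(g x / 2)) • fderiv ℝ G x)) x := by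
  have hG' := (hG.differentiable (by simp) x).hasFDerivAt
  have hg' := (hg.1.differentiable (by simp) x).hasFDerivAt
  have h := hg'.mul ((hG'.neg.mul_const (2⁻¹ : ℝ)).exp)
  simp only [← div_eq_mul_inv] at h
  refine h.congr_fderiv ?_
  ext v
  simp
  ring

lemma isTestFun_mul_exp_neg_half (hG : ContDiff ℝ (⊤ : ℕ∞) G) (hGK : LipschitzWith K G) {B : ℝ}
    (hB : ∀ x, -B ≤ G x) (hg : IsTestFun g) : IsTestFun fun x ↦ g x * exp (-G x / 2) := by
  have hd := hasFDerivAt_mul_exp_neg_half hG hg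
  obtain ⟨h1, ⟨A, hA⟩, K', hK'⟩ := hg
  have hA0 : 0 ≤ A := (abs_nonneg _).trans (hA 0)
  have he : ∀ x, exp (-G x / 2) ≤ exp (B / 2) := fun x ↦ exp_le_exp.2 (by linarith [hB x])
  refine ⟨h1.mul (Real.contDiff_exp.comp (hG.neg.div_const 2)), ⟨A * exp (B / 2), fun x ↦ ?_⟩,
    (exp (B / 2) * (K' + A / 2 * K)).toNNReal,
    lipschitzWith_of_nnnorm_fderiv_le (𝕜 := ℝ) (fun x ↦ (hd x).differentiableAt) fun x ↦ ?_⟩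
  · rw [abs_mul, abs_exp]
    exact mul_le_mul (hA x) (he x) (exp_pos _).le hA0
  · rw [← NNReal.coe_le_coe, coe_nnnorm, coe_toNNReal _ (by positivity), (hd x).fderiv, norm_smul,
      Real.norm_eq_abs, abs_exp]
    refine mul_le_mul (he x) ((norm_add_le _ _).trans (add_le_add
      (norm_fderiv_le_of_lipschitz ℝ hK') ?_)) (norm_nonneg _) (exp_pos _).le
    rw [norm_smul, norm_neg, norm_div, Real.norm_eq_abs, Real.norm_ofNat]
    exact mul_le_mul (by gcongr; exact hA x) (norm_fderiv_le_of_lipschitz ℝ hGK) (norm_nonneg _)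
      (by positivity)

lemma norm_gradient_mul_exp_neg_half_sq_le (hG : ContDiff ℝ (⊤ : ℕ∞) G) (hGK : LipschitzWith K G)
    (hg : IsTestFun g) {θ : ℝ} (hθ : 0 < θ) (x : En n) :
    ‖gradient (fun x ↦ g x * exp (-G x / 2)) x‖ ^ 2 ≤
      (1 + θ⁻¹) * (‖gradient g x‖ ^ 2 * exp (-G x))
        + (1 + θ) / 4 * K ^ 2 * (g x ^ 2 * exp (-G x)) := by
  have he : exp (-G x / 2) ^ 2 = exp (-G x) := by
    rw [← exp_nat_mul]
    congr 1
    push_cast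
    ring
  rw [norm_gradient_eq_norm_fderiv, norm_gradient_eq_norm_fderiv,
    (hasFDerivAt_mul_exp_neg_half hG hg x).fderiv, norm_smul, Real.norm_eq_abs, abs_exp, mul_pow, he]
  have h1 := norm_add_sq_le_of_pos (fderiv ℝ g x) ((-(g x / 2)) • fderiv ℝ G x) hθ
  have h2 : ‖(-(g x / 2)) • fderiv ℝ G x‖ ^ 2 ≤ g x ^ 2 / 4 * K ^ 2 := by
    rw [norm_smul, mul_pow, norm_neg, Real.norm_eq_abs, sq_abs, div_pow]
    have := norm_fderiv_le_of_lipschitz ℝ hGK (x₀ := x)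
    norm_num
    gcongr
  calc _ ≤ exp (-G x) * ((1 + θ⁻¹) * ‖fderiv ℝ g x‖ ^ 2 + (1 + θ) * (g x ^ 2 / 4 * K ^ 2)) := by
        gcongr
        exact h1.trans (by gcongr)
    _ = _ := by ring

variable {μ : Measure (En n)} {C : ℝ}

lemma integrable_mul_exp_neg (hGi : Integrable (fun x ↦ exp (-G x)) μ) {φ : En n → ℝ}
    (hφ : Continuous φ) {B : ℝ} (hB : ∀ x, |φ x| ≤ B) :
    Integrable (fun x ↦ φ x * exp (-G x)) μ :=
  hGi.bdd_mul hφ.aestronglyMeasurable (ae_of_all _ hB)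

lemma IsTestFun.exists_abs_sq_le (hg : IsTestFun g) : ∃ B, ∀ x, |g x ^ 2| ≤ B := by
  obtain ⟨A, hA⟩ := hg.2.1
  refine ⟨A ^ 2, fun x ↦ ?_⟩
  rw [abs_pow]
  have := hA x
  gcongr

lemma IsTestFun.exists_abs_sq_mul_log_sq_le (hg : IsTestFun g) :
    ∃ B, ∀ x, |g x ^ 2 * log (g x ^ 2)| ≤ B := by
  obtain ⟨A, hA⟩ := hg.2.1
  obtain ⟨B, hB⟩ := (isCompact_Icc (a := -A) (b := A)).exists_bound_of_continuousOn
    continuous_sq_mul_log_sq.continuousOn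
  exact ⟨B, fun x ↦ hB _ (abs_le.1 (hA x))⟩

lemma LogSobolevLE.entropy_mul_exp_neg_le_of_contDiff [IsFiniteMeasure μ] (hC : 0 ≤ C)
    (hμ : LogSobolevLE μ C) (hG : ContDiff ℝ (⊤ : ℕ∞) G) (hGK : LipschitzWith K G) {B m : ℝ}
    (hB : ∀ x, -B ≤ G x) (hm : ∀ x, G x ≤ m) (hg : IsTestFun g) {θ : ℝ} (hθ : 0 < θ) :
    ∫ x, g x ^ 2 * log (g x ^ 2) * exp (-G x) ∂μ
        - (∫ x, g x ^ 2 * exp (-G x) ∂μ) * log (∫ x, g x ^ 2 * exp (-G x) ∂μ) ≤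
      C * ((1 + θ⁻¹) * ∫ x, ‖gradient g x‖ ^ 2 * exp (-G x) ∂μ
        + (1 + θ) / 4 * K ^ 2 * ∫ x, g x ^ 2 * exp (-G x) ∂μ)
        + m * ∫ x, g x ^ 2 * exp (-G x) ∂μ := by
  have hGc := hGK.continuous
  have hgc := hg.1.continuous
  have hE : Integrable (fun x ↦ exp (-G x)) μ :=
    Integrable.of_bound (by fun_prop) (exp B) (ae_of_all _ fun x ↦ by
      rw [Real.norm_eq_abs, abs_exp]
      exact exp_le_exp.2 (by linarith [hB x]))
  obtain ⟨B1, hB1⟩ := hg.exists_abs_sq_le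
  obtain ⟨B2, hB2⟩ := hg.exists_abs_sq_mul_log_sq_le
  obtain ⟨B3, hB3⟩ := hg.exists_norm_gradient_sq_le
  have i1 : Integrable (fun x ↦ g x ^ 2 * exp (-G x)) μ :=
    integrable_mul_exp_neg hE (hgc.pow 2) hB1
  have i2 : Integrable (fun x ↦ g x ^ 2 * log (g x ^ 2) * exp (-G x)) μ :=
    integrable_mul_exp_neg hE (continuous_sq_mul_log_sq.comp hgc) hB2
  have i3 := integrable_mul_exp_neg hE hg.continuous_norm_gradient_sq
    fun x ↦ (abs_of_nonneg (by positivity)).trans_le (hB3 x)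
  have hT := isTestFun_mul_exp_neg_half hG hGK hB hg
  have h := hμ _ hT
  have hsq : ∀ x, (g x * exp (-G x / 2)) ^ 2 = g x ^ 2 * exp (-G x) := fun x ↦ by
    rw [mul_pow, ← exp_nat_mul]
    congr 2
    push_cast
    ring
  have hTi : Integrable (fun x ↦ ‖gradient (fun x ↦ g x * exp (-G x / 2)) x‖ ^ 2) μ := by
    obtain ⟨B4, hB4⟩ := hT.exists_norm_gradient_sq_le
    exact Integrable.of_bound hT.continuous_norm_gradient_sq.aestronglyMeasurable B4
      (ae_of_all _ fun x ↦ (abs_of_nonneg (by positivity)).trans_le (hB4 x))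
  have hgrad := integral_mono hTi ((i3.const_mul (1 + θ⁻¹)).add
    (i1.const_mul ((1 + θ) / 4 * K ^ 2))) (norm_gradient_mul_exp_neg_half_sq_le hG hGK hg hθ)
  simp only [Pi.add_apply] at hgrad
  rw [integral_add (i3.const_mul _) (i1.const_mul _), integral_const_mul, integral_const_mul]
    at hgrad
  have hTl : Integrable (fun x ↦ (g x * exp (-G x / 2)) ^ 2 * log ((g x * exp (-G x / 2)) ^ 2))
      μ := by
    obtain ⟨B5, hB5⟩ := hT.exists_abs_sq_mul_log_sq_le
    exact Integrable.of_bound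
      (continuous_sq_mul_log_sq.comp hT.1.continuous).aestronglyMeasurable B5 (ae_of_all _ hB5)
  have hent := integral_mono (i2.sub (i1.const_mul m)) hTl fun x ↦ by
    change g x ^ 2 * log (g x ^ 2) * exp (-G x) - m * (g x ^ 2 * exp (-G x)) ≤ _
    rw [hsq]
    rcases eq_or_ne (g x) 0 with h0 | h0
    · simp [h0]
    · rw [log_mul (by positivity) (exp_pos _).ne', log_exp]
      have : 0 ≤ (m - G x) * (g x ^ 2 * exp (-G x)) :=
        mul_nonneg (sub_nonneg.2 (hm x)) (by positivity)
      linarith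
  simp only [Pi.sub_apply] at hent
  rw [integral_sub i2 (i1.const_mul m), integral_const_mul] at hent
  simp only [hsq] at h hent
  have := mul_le_mul_of_nonneg_left hgrad hC
  linarith

lemma LogSobolevLE.entropy_mul_exp_neg_le [IsFiniteMeasure μ] (hC : 0 ≤ C)
    (hμ : LogSobolevLE μ C) (hGK : LipschitzWith K G) {M : ℝ} (hM0 : 0 ≤ M)
    (hM : ∀ x, G x ≤ M) (hGi : Integrable (fun x ↦ exp (-G x)) μ) (hg : IsTestFun g) {θ : ℝ}
    (hθ : 0 < θ) :
    ∫ x, g x ^ 2 * log (g x ^ 2) * exp (-G x) ∂μ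
        - (∫ x, g x ^ 2 * exp (-G x) ∂μ) * log (∫ x, g x ^ 2 * exp (-G x) ∂μ) ≤
      C * ((1 + θ⁻¹) * ∫ x, ‖gradient g x‖ ^ 2 * exp (-G x) ∂μ
        + (1 + θ) / 4 * K ^ 2 * ∫ x, g x ^ 2 * exp (-G x) ∂μ)
        + M * ∫ x, g x ^ 2 * exp (-G x) ∂μ := by
  have hgc := hg.1.continuous
  have hεpos : ∀ j : ℕ, 0 < 1 / ((j : ℝ) + 1) := fun j ↦ by positivity
  have happ := fun j : ℕ ↦ (hGK.max_const (-(j : ℝ))).exists_contDiff_dist_le (hεpos j)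
  choose H hHs hHK hHd using happ
  have hHd' := fun j x ↦ abs_le.1 (hHd j x)
  have hε := tendsto_one_div_add_atTop_nhds_zero_nat (𝕜 := ℝ)
  have hε1 : ∀ j : ℕ, 1 / ((j : ℝ) + 1) ≤ 1 := fun j ↦ by
    rw [div_le_one (by positivity)]
    linarith [(Nat.cast_nonneg j : (0 : ℝ) ≤ j)]
  have hlim : ∀ x, Filter.Tendsto (fun j ↦ H j x) Filter.atTop (nhds (G x)) := fun x ↦ by
    obtain ⟨N, hN⟩ := exists_nat_ge (-G x)
    refine tendsto_iff_dist_tendsto_zero.2 (squeeze_zero' (.of_forall fun _ ↦ dist_nonneg) ?_ hε)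
    filter_upwards [Filter.eventually_ge_atTop N] with j hj
    have hNj : (N : ℝ) ≤ j := by exact_mod_cast hj
    have := hHd j x
    rwa [max_eq_left (by linarith)] at this
  have hconv : ∀ φ : En n → ℝ, Continuous φ → (∃ B, ∀ x, |φ x| ≤ B) →
      Filter.Tendsto (fun j ↦ ∫ x, φ x * exp (-H j x) ∂μ) Filter.atTop
        (nhds (∫ x, φ x * exp (-G x) ∂μ)) := by
    rintro φ hφ ⟨B, hB⟩
    refine tendsto_integral_of_dominated_convergence (fun x ↦ B * (exp 1 * exp (-G x)))
      (fun j ↦ ?_) ((hGi.const_mul _).const_mul _) (fun j ↦ ae_of_all _ fun x ↦ ?_)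
      (ae_of_all _ fun x ↦ (((Real.continuous_exp.tendsto _).comp (hlim x).neg)).const_mul _)
    · have := (hHs j).continuous
      exact (by fun_prop : Continuous fun x ↦ φ x * exp (-H j x)).aestronglyMeasurable
    · rw [norm_mul, Real.norm_eq_abs, Real.norm_eq_abs, abs_exp, ← exp_add]
      refine mul_le_mul (hB x) (exp_le_exp.2 ?_) (exp_pos _).le ((abs_nonneg _).trans (hB x))
      linarith [(hHd' j x).1, le_max_left (G x) (-(j : ℝ)), hε1 j]
  have l1 := hconv _ (hgc.pow 2) hg.exists_abs_sq_le
  have l2 := hconv _ (continuous_sq_mul_log_sq.comp hgc) hg.exists_abs_sq_mul_log_sq_le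
  have l3 := hconv _ hg.continuous_norm_gradient_sq
    (hg.exists_norm_gradient_sq_le.imp fun B hB x ↦
      (abs_of_nonneg (by positivity)).trans_le (hB x))
  have lm : Filter.Tendsto (fun j : ℕ ↦ M + 1 / ((j : ℝ) + 1)) Filter.atTop (nhds M) := by
    simpa using hε.const_add M
  refine le_of_tendsto_of_tendsto' (l2.sub ((continuous_mul_log.tendsto _).comp l1))
    ((((l3.const_mul (1 + θ⁻¹)).add (l1.const_mul ((1 + θ) / 4 * K ^ 2))).const_mul C).add
      (lm.mul l1)) fun j ↦ ?_
  refine hμ.entropy_mul_exp_neg_le_of_contDiff hC (hHs j) (hHK j) (B := j + 1) (fun x ↦ ?_)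
    (fun x ↦ ?_) hg hθ
  · linarith [(hHd' j x).1, le_max_right (G x) (-(j : ℝ)), hε1 j]
  · have : max (G x) (-(j : ℝ)) ≤ M :=
      max_le (hM x) (by linarith [(Nat.cast_nonneg j : (0 : ℝ) ≤ j)])
    linarith [(hHd' j x).2]

end Approximation

lemma measSupport_mem_ae {n : ℕ} (μ : Measure (En n)) : ∀ᵐ x ∂μ, x ∈ measSupport μ := by
  filter_upwards [Measure.support_mem_ae (μ := μ)] with x hx
  exact (Measure.mem_support_iff_forall x).1 hx

lemma perturb_eq_withDensity {n : ℕ} {μ : Measure (En n)} {F G : En n → ℝ} (hFG : F =ᵐ[μ] G)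
    (hF : ∫ x, exp (-F x) ∂μ = 1) :
    perturb μ F = μ.withDensity fun x ↦ ENNReal.ofReal (exp (-G x)) := by
  rw [perturb, hF, ENNReal.ofReal_one, inv_one, one_smul]
  refine withDensity_congr_ae ?_
  filter_upwards [hFG] with x hx
  rw [hx]

/-- If `F` is `L`-Lipschitz on the support of `μ`, `μ(e^{-F}) = 1`,
`C_{LS}(μ) < ∞` and `sup_{supp μ} F = M`, then for all `θ > 0`,
`C_{LS}(μ_F) ≤ (1+θ⁻¹) C_{LS}(μ) + C_P(μ_F) ((1+θ)/4 · L² C_{LS}(μ) + M + 2)`. -/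
theorem logSobolev_of_bounded_above_perturbation
    {n : ℕ} (μ : Measure (En n)) [IsProbabilityMeasure μ] (V : En n → ℝ)
    (hμ : μ = volume.withDensity fun x => ENNReal.ofReal (Real.exp (-V x)))
    (F : En n → ℝ) (L : ℝ) (hL : 0 ≤ L)
    (hFlip : LipschitzOnWith (Real.toNNReal L) F (measSupport μ))
    (hnorm : ∫ x, Real.exp (-F x) ∂μ = 1)
    (Cls : ℝ) (hCls : 0 ≤ Cls) (hLS : LogSobolevLE μ Cls)
    (M : ℝ) (hM : ∀ x ∈ measSupport μ, F x ≤ M)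
    (CPF : ℝ) (hCPF : 0 ≤ CPF) (hPF : PoincareLE (perturb μ F) CPF)
    (θ : ℝ) (hθ : 0 < θ) :
    LogSobolevLE (perturb μ F)
      ((1 + θ⁻¹) * Cls + CPF * ((1 + θ) / 4 * L ^ 2 * Cls + M + 2)) := by
  obtain ⟨G₀, hG₀K, hG₀F⟩ := hFlip.extend_real
  set G : En n → ℝ := fun x ↦ min (G₀ x) M
  have hGK : LipschitzWith L.toNNReal G := hG₀K.min_const M
  have hGM : ∀ x, G x ≤ M := fun x ↦ min_le_right _ _
  have hFG : F =ᵐ[μ] G := by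
    filter_upwards [measSupport_mem_ae μ] with x hx
    simp only [G, ← hG₀F hx, min_eq_left (hM x hx)]
  have hGi1 : ∫ x, exp (-G x) ∂μ = 1 := by
    rw [← hnorm]
    refine integral_congr_ae ?_
    filter_upwards [hFG] with x hx
    rw [hx]
  have hGi : Integrable (fun x ↦ exp (-G x)) μ :=
    not_imp_comm.1 integral_undef (by rw [hGi1]; exact one_ne_zero)
  have hM0 : 0 ≤ M := by
    have := integral_mono (integrable_const (μ := μ) (exp (-M))) hGi
      fun x ↦ exp_le_exp.2 (neg_le_neg (hGM x))
    rw [hGi1, integral_const, probReal_univ, one_smul, exp_le_one_iff] at this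
    linarith
  rw [perturb_eq_withDensity hFG hnorm] at hPF ⊢
  set ν := μ.withDensity fun x ↦ ENNReal.ofReal (exp (-G x))
  have hGm : Measurable G := hGK.continuous.measurable
  have hν : ∀ φ : En n → ℝ, ∫ x, φ x ∂ν = ∫ x, φ x * exp (-G x) ∂μ := fun φ ↦ by
    rw [integral_withDensity_eq_integral_toReal_smul (by fun_prop) (by simp)]
    simp only [ENNReal.toReal_ofReal (exp_pos _).le, smul_eq_mul, mul_comm]
  have : IsProbabilityMeasure ν := ⟨by
    rw [withDensity_apply _ .univ, Measure.restrict_univ,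
      ← ofReal_integral_eq_lintegral_ofReal hGi (ae_of_all _ fun x ↦ (exp_pos _).le), hGi1,
      ENNReal.ofReal_one]⟩
  intro f hf
  obtain ⟨A, hA⟩ := hf.2.1
  have hfm := hf.1.continuous.measurable
  have i1 : Integrable f ν := integrable_comp_of_continuous_of_bound hfm hA continuous_id
  have i2 : Integrable (fun x ↦ f x ^ 2) ν :=
    integrable_comp_of_continuous_of_bound hfm hA (continuous_pow 2)
  set m := ∫ x, f x ∂ν with hm
  set g : En n → ℝ := fun x ↦ f x - m with hgdef
  have hg : IsTestFun g := hf.sub_const m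
  obtain ⟨A', hA'⟩ := hg.2.1
  have hgrad : ∀ x, ‖gradient g x‖ = ‖gradient f x‖ := fun x ↦ by
    rw [norm_gradient_eq_norm_fderiv, norm_gradient_eq_norm_fderiv, hgdef, fderiv_sub_const]
  have hg0 : ∫ x, g x ∂ν = 0 := by
    rw [hgdef, integral_sub i1 (integrable_const _)]
    simp [hm]
  have hg2 : ∫ x, g x ^ 2 ∂ν = ∫ x, f x ^ 2 ∂ν - m ^ 2 := by
    have : ∀ x, g x ^ 2 = f x ^ 2 - 2 * m * f x + m ^ 2 := fun x ↦ by simp only [hgdef]; ring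
    simp_rw [this]
    rw [integral_add (by fun_prop) (by fun_prop),
      integral_sub i2 (i1.const_mul _), integral_const_mul, ← hm]
    simp
    ring
  have hpoin : ∫ x, g x ^ 2 ∂ν ≤ CPF * ∫ x, ‖gradient f x‖ ^ 2 ∂ν := hg2.trans_le (hPF f hf)
  have hroth := entropy_add_const_le (ν := ν) hg.1.continuous.measurable hA' hg0 m
  have hls := hLS.entropy_mul_exp_neg_le hCls hGK hM0 hGM hGi hg hθ
  simp only [← hν, hgrad, coe_toNNReal L hL] at hls
  simp only [hgdef, sub_add_cancel] at hroth
  have hmul := mul_le_mul_of_nonneg_left hpoin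
    (by positivity : 0 ≤ (1 + θ) / 4 * L ^ 2 * Cls + M + 2)
  linarith
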